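/- arXiv:1504.01713 — 2 statements merged into one kernel-verified Lean document; each statement's English description precedes it below -/
import Mathlib

section
/- Let H be a semiconvergent n × n complex matrix. Then for every positive integer ℓ, ker(I − H^ℓ) = ker(I − H); consequently rank(I − H^ℓ) = rank(I − H) for all ℓ ≥ 1. -/
/-- A square matrix `H` is *semiconvergent* if `lim_{i → ∞} H ^ i` exists. -/
def Semiconvergent {n : ℕ} (H : Matrix (Fin n) (Fin n) ℂ) : Prop :=
  ∃ L : Matrix (Fin n) (Fin n) ℂ, Filter.Tendsto (fun i : ℕ => H ^ i) Filter.atTop (nhds L)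

/-- A fixed vector of `H ^ ℓ` with `0 < ℓ` is a fixed vector of `H`, when `H` is semiconvergent. -/
theorem Semiconvergent.mulVec_eq_of_pow_mulVec_eq {n : ℕ} {H : Matrix (Fin n) (Fin n) ℂ}
    (hH : Semiconvergent H) {ℓ : ℕ} (hℓ : 0 < ℓ) {v : Fin n → ℂ}
    (hv : (H ^ ℓ).mulVec v = v) : H.mulVec v = v := by
  obtain ⟨L, hL⟩ := hH
  have hfix (k : ℕ) : (H ^ (ℓ * k)).mulVec v = v := by
    induction k with
    | zero => simp
    | succ k ih => rw [Nat.mul_succ, pow_add, ← Matrix.mulVec_mulVec, hv, ih]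
  have hlim : Filter.Tendsto (fun i : ℕ => (H ^ i).mulVec v) Filter.atTop (nhds (L.mulVec v)) :=
    ((continuous_id.matrix_mulVec continuous_const).tendsto L).comp hL
  have hmul : Filter.Tendsto (fun k : ℕ => ℓ * k) Filter.atTop Filter.atTop :=
    Filter.tendsto_id.const_mul_atTop' hℓ
  have hv' : L.mulVec v = v :=
    tendsto_nhds_unique (hlim.comp hmul) (tendsto_const_nhds.congr fun k => (hfix k).symm)
  have hHv : L.mulVec v = H.mulVec v :=
    tendsto_nhds_unique (hlim.comp ((Filter.tendsto_add_atTop_nat 1).comp hmul))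
      (tendsto_const_nhds.congr fun k => by
        simp only [Function.comp_apply]
        rw [pow_succ', ← Matrix.mulVec_mulVec, hfix k])
  exact hHv.symm.trans hv'

/-- If `H` is semiconvergent, then `ker (I - H ^ ℓ) = ker (I - H)` for all `ℓ ≥ 1`,
and consequently `rank (I - H ^ ℓ) = rank (I - H)`. -/
theorem ker_one_sub_pow_of_semiconvergent {n : ℕ} (H : Matrix (Fin n) (Fin n) ℂ)
    (hH : Semiconvergent H) :
    ∀ ℓ : ℕ, 0 < ℓ →
      LinearMap.ker ((1 - H ^ ℓ).mulVecLin) = LinearMap.ker ((1 - H).mulVecLin) ∧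
        (1 - H ^ ℓ).rank = (1 - H).rank := by
  intro ℓ hℓ
  have hker : LinearMap.ker ((1 - H ^ ℓ).mulVecLin) = LinearMap.ker ((1 - H).mulVecLin) := by
    ext v
    simp only [LinearMap.mem_ker, Matrix.mulVecLin_apply, Matrix.sub_mulVec, Matrix.one_mulVec,
      sub_eq_zero]
    refine ⟨fun h => (hH.mulVec_eq_of_pow_mulVec_eq hℓ h.symm).symm, fun h => ?_⟩
    clear hℓ
    induction ℓ with
    | zero => simp
    | succ k ih => rw [pow_succ, ← Matrix.mulVec_mulVec, ← h, ← ih]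
  refine ⟨hker, ?_⟩
  have h₁ := (1 - H ^ ℓ).mulVecLin.finrank_range_add_finrank_ker
  have h₂ := (1 - H).mulVecLin.finrank_range_add_finrank_ker
  rw [hker] at h₁
  exact Nat.add_right_cancel (h₁.trans h₂.symm)
end

section
/- Let A and M be n × n complex matrices with M invertible, let = M⁻¹A, and for a positive integer ℓ let C^{(ℓ)} = ∑_{i=0}^{ℓ−1} (I − Â)^i M⁻¹. Then for every nonnegative integer k, (C^{(ℓ)}A)^k C^{(ℓ)} = (∑_{i=0}^{ℓ−1} (I − Â)^i)^{k+1} Â^k M⁻¹; consequently (C^{(ℓ)}A)^k C^{(ℓ)} r₀ lies in the Krylov subspace K_{(k+1)ℓ}(Â, M⁻¹r₀) for every vector r₀. -/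
/-- The Krylov subspace of order `k`: `K_k(B, v) = span {v, Bv, …, B^{k-1} v}`. -/
noncomputable def krylov {n : ℕ} (B : Matrix (Fin n) (Fin n) ℂ) (v : Fin n → ℂ) (k : ℕ) :
    Submodule ℂ (Fin n → ℂ) :=
  Submodule.span ℂ {w | ∃ i < k, w = (B ^ i).mulVec v}

open Polynomial in
/-- A polynomial in `B` of degree below `m`, applied to `v`, lies in `K_m(B, v)`. -/
lemma aeval_mulVec_mem_krylov {n : ℕ} (B : Matrix (Fin n) (Fin n) ℂ) (v : Fin n → ℂ) {m : ℕ}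
    {p : ℂ[X]} (hp : p.natDegree < m) : (aeval B p).mulVec v ∈ krylov B v m := by
  rw [aeval_eq_sum_range' hp, Matrix.sum_mulVec]
  refine Submodule.sum_mem _ fun i hi => ?_
  rw [Matrix.smul_mulVec]
  exact Submodule.smul_mem _ _ (Submodule.subset_span ⟨i, Finset.mem_range.mp hi, rfl⟩)

open Polynomial in
lemma natDegree_sum_one_sub_X_pow_le (R : Type*) [CommRing R] (ℓ : ℕ) :
    (∑ i ∈ Finset.range ℓ, (1 - X : R[X]) ^ i).natDegree ≤ ℓ - 1 := by
  refine natDegree_sum_le_of_forall_le _ _ fun i hi => ?_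
  have hX : (1 - X : R[X]).natDegree ≤ 1 := by compute_degree
  have hpow := natDegree_pow_le_of_le i hX
  have hlt := Finset.mem_range.mp hi
  omega

/-- If `S` commutes with `N * A`, the powers of `S * N * A` can be collected. -/
lemma mul_mul_pow_mul_of_commute {R : Type*} [Monoid R] {S N A : R} (h : Commute S (N * A))
    (k : ℕ) : (S * N * A) ^ k * (S * N) = S ^ (k + 1) * (N * A) ^ k * N := by
  rw [mul_assoc S N A, h.mul_pow, mul_assoc (S ^ k), ← mul_assoc ((N * A) ^ k),
    ← (h.pow_right k).eq, pow_succ]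
  simp only [mul_assoc]

/-- With `Â = M⁻¹ A` and `C⁽ˡ⁾ = ∑_{i=0}^{ℓ-1} (I - Â)^i M⁻¹`, for every `k ≥ 0` one has
`(C⁽ˡ⁾ A)^k C⁽ˡ⁾ = (∑_{i=0}^{ℓ-1} (I - Â)^i)^{k+1} Â^k M⁻¹`; consequently
`(C⁽ˡ⁾ A)^k C⁽ˡ⁾ r₀ ∈ K_{(k+1)ℓ}(Â, M⁻¹ r₀)` for every vector `r₀`. -/
theorem preconditioned_power_formula {n : ℕ}
    (A M : Matrix (Fin n) (Fin n) ℂ) (hM : IsUnit M)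
    (Ahat : Matrix (Fin n) (Fin n) ℂ) (hAhat : Ahat = M⁻¹ * A)
    (ℓ : ℕ) (hℓ : 0 < ℓ)
    (C : Matrix (Fin n) (Fin n) ℂ)
    (hC : C = (∑ i ∈ Finset.range ℓ, (1 - Ahat) ^ i) * M⁻¹) (k : ℕ) :
    (C * A) ^ k * C =
        (∑ i ∈ Finset.range ℓ, (1 - Ahat) ^ i) ^ (k + 1) * Ahat ^ k * M⁻¹ ∧
      ∀ r₀ : Fin n → ℂ,
        ((C * A) ^ k * C).mulVec r₀ ∈ krylov Ahat (M⁻¹.mulVec r₀) ((k + 1) * ℓ) := by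
  have hcomm : Commute (∑ i ∈ Finset.range ℓ, (1 - Ahat) ^ i) Ahat :=
    Commute.sum_left _ _ _ fun i _ => ((Commute.one_left Ahat).sub_left (.refl Ahat)).pow_left i
  have hformula : (C * A) ^ k * C =
      (∑ i ∈ Finset.range ℓ, (1 - Ahat) ^ i) ^ (k + 1) * Ahat ^ k * M⁻¹ := by
    rw [hAhat] at hcomm hC ⊢
    rw [hC]
    exact mul_mul_pow_mul_of_commute hcomm k
  refine ⟨hformula, fun r₀ => ?_⟩
  have hdeg : ((∑ i ∈ Finset.range ℓ, (1 - Polynomial.X : Polynomial ℂ) ^ i) ^ (k + 1) *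
      Polynomial.X ^ k).natDegree < (k + 1) * ℓ := by
    have hle := Polynomial.natDegree_mul_le_of_le
      (Polynomial.natDegree_pow_le_of_le (k + 1) (natDegree_sum_one_sub_X_pow_le ℂ ℓ))
      (Polynomial.natDegree_X_pow_le (R := ℂ) k)
    obtain ⟨m, rfl⟩ := Nat.exists_eq_add_of_lt hℓ
    simp only [zero_add, Nat.add_sub_cancel] at hle ⊢
    rw [mul_add, mul_one]
    omega
  rw [hformula, ← Matrix.mulVec_mulVec]
  simpa using aeval_mulVec_mem_krylov Ahat (M⁻¹.mulVec r₀) hdeg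
end
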